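/- Let D be a positive integer, δ ∈ (0, 1], and α = δ/(2√6 D). Let μ ∈ ℝ^D and Σ̃ a D×D symmetric positive definite real matrix, and define l(x) = (1+2α)^{−D} Φ_D(x; μ, (1+α)⁻¹Σ̃) and u(x) = (1+2α)^{D} Φ_D(x; μ, (1+α)Σ̃). Then ∫_{ℝ^D} ( l(x) + u(x) − 2√(l(x)u(x)) ) dx ≤ 2( 2 cosh(1/√6) α² D² + α² D²/4 ) ≤ 6 α² D² = δ²/4. -/

import Mathlib

open Matrix MeasureTheory

/-- Gaussian density `Φ_d(x; μ, Σ)` on `ℝ^d`. -/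
noncomputable def gaussianPdf (d : ℕ) (μ : Fin d → ℝ) (S : Matrix (Fin d) (Fin d) ℝ)
    (x : Fin d → ℝ) : ℝ :=
  (2 * Real.pi) ^ (-(d : ℝ) / 2) * S.det ^ (-(1 : ℝ) / 2) *
    Real.exp (-(1 / 2 : ℝ) * ((x - μ) ⬝ᵥ (S⁻¹ *ᵥ (x - μ))))

open scoped MatrixOrder in
lemma exists_factor {D : ℕ} (P : Matrix (Fin D) (Fin D) ℝ) (hP : P.PosDef) :
    ∃ B : Matrix (Fin D) (Fin D) ℝ, P = Bᵀ * B := by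
  obtain ⟨B, hB⟩ := CStarAlgebra.nonneg_iff_eq_star_mul_self.mp hP.posSemidef.nonneg
  exact ⟨B, by rw [hB, star_eq_conjTranspose, conjTranspose_eq_transpose_of_trivial]⟩

lemma integral_quad {D : ℕ} (P : Matrix (Fin D) (Fin D) ℝ) (hP : P.PosDef) (μ : Fin D → ℝ)
    (b : ℝ) :
    ∫ x : Fin D → ℝ, Real.exp (-b * ((x - μ) ⬝ᵥ (P *ᵥ (x - μ)))) =
      (Real.sqrt P.det)⁻¹ * Real.sqrt (Real.pi / b) ^ D := by
  obtain ⟨B, hB⟩ := exists_factor P hP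
  have hdet : P.det = B.det ^ 2 := by rw [hB, det_mul, det_transpose, sq]
  have hB0 : B.det ≠ 0 := by
    intro h
    have := hP.det_pos
    rw [hdet, h] at this
    simp at this
  rw [integral_sub_right_eq_self (fun x : Fin D → ℝ => Real.exp (-b * (x ⬝ᵥ (P *ᵥ x)))) μ]
  have h1 : ∀ x : Fin D → ℝ, Real.exp (-b * (x ⬝ᵥ (P *ᵥ x))) =
      (fun y : Fin D → ℝ => ∏ i, Real.exp (-b * y i ^ 2)) (toLin' B x) := by
    intro x
    simp only [toLin'_apply]
    rw [← Real.exp_sum, ← Finset.mul_sum, hB, ← mulVec_mulVec, dotProduct_mulVec,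
      vecMul_transpose]
    simp [dotProduct, sq]
  simp_rw [h1]
  have hmap := Real.map_matrix_volume_pi_eq_smul_volume_pi hB0
  have hcont : Continuous (toLin' B) := LinearMap.continuous_of_finiteDimensional _
  rw [← integral_map (f := fun y : Fin D → ℝ => ∏ i, Real.exp (-b * y i ^ 2))
    hcont.aemeasurable (Continuous.aestronglyMeasurable (by fun_prop)), hmap, integral_smul_measure,
    integral_fintype_prod_volume_eq_pow (fun y : ℝ => Real.exp (-b * y ^ 2)), integral_gaussian,
    hdet, Real.sqrt_sq_eq_abs, ENNReal.toReal_ofReal (abs_nonneg _), abs_inv]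
  simp

lemma integral_gaussianPdf {D : ℕ} (S : Matrix (Fin D) (Fin D) ℝ) (hS : S.PosDef)
    (μ : Fin D → ℝ) : ∫ x, gaussianPdf D μ S x = 1 := by
  unfold gaussianPdf
  have hd := hS.det_pos
  have hpi : (0 : ℝ) < 2 * Real.pi := by positivity
  rw [integral_const_mul, integral_quad _ hS.inv]
  rw [show Real.pi / (1 / 2) = 2 * Real.pi by ring, det_nonsing_inv, Ring.inverse_eq_inv',
    Real.sqrt_inv, inv_inv, Real.sqrt_eq_rpow, Real.sqrt_eq_rpow, ← Real.rpow_mul_natCast hpi.le]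
  have e1 : (2 * Real.pi) ^ (-(D : ℝ) / 2) * (2 * Real.pi) ^ ((1 / 2 : ℝ) * D) = 1 := by
    rw [← Real.rpow_add hpi, show -(D : ℝ) / 2 + 1 / 2 * D = 0 by ring, Real.rpow_zero]
  have e2 : S.det ^ (-(1 : ℝ) / 2) * S.det ^ (1 / 2 : ℝ) = 1 := by
    rw [← Real.rpow_add hd, show -(1 : ℝ) / 2 + 1 / 2 = 0 by ring, Real.rpow_zero]
  calc _ = ((2 * Real.pi) ^ (-(D : ℝ) / 2) * (2 * Real.pi) ^ ((1 / 2 : ℝ) * D)) *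
      (S.det ^ (-(1 : ℝ) / 2) * S.det ^ (1 / 2 : ℝ)) := by ring
    _ = 1 := by rw [e1, e2, one_mul]

lemma integrable_gaussianPdf {D : ℕ} (S : Matrix (Fin D) (Fin D) ℝ) (hS : S.PosDef)
    (μ : Fin D → ℝ) : Integrable (gaussianPdf D μ S) := by
  by_contra h
  have := integral_gaussianPdf S hS μ
  rw [integral_undef h] at this
  exact zero_ne_one this

lemma gaussianPdf_smul {D : ℕ} (S : Matrix (Fin D) (Fin D) ℝ) (hS : S.PosDef)
    (μ : Fin D → ℝ) (s : ℝ) (hs : 0 < s) (x : Fin D → ℝ) :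
    gaussianPdf D μ (s • S) x = (2 * Real.pi) ^ (-(D : ℝ) / 2) * S.det ^ (-(1 : ℝ) / 2) *
      (s ^ (-(D : ℝ) / 2) *
      Real.exp (-(1 / 2 : ℝ) * (s⁻¹ * ((x - μ) ⬝ᵥ (S⁻¹ *ᵥ (x - μ)))))) := by
  unfold gaussianPdf
  have hd := hS.det_pos
  have hinv : (s • S)⁻¹ = s⁻¹ • S⁻¹ := by
    have := Matrix.inv_smul' (A := S) (Units.mk0 s hs.ne') (isUnit_iff_ne_zero.mpr hd.ne')
    simpa [Units.smul_def] using this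
  rw [hinv, det_smul, Fintype.card_fin, Real.mul_rpow (by positivity) hd.le, smul_mulVec,
    dotProduct_smul, smul_eq_mul, ← Real.rpow_natCast_mul hs.le,
    show (D : ℝ) * (-1 / 2) = -(D : ℝ) / 2 by ring]
  ring

lemma sqrt_gaussianPdf {D : ℕ} (S : Matrix (Fin D) (Fin D) ℝ) (hS : S.PosDef)
    (μ : Fin D → ℝ) (a : ℝ) (ha : 0 < a) (x : Fin D → ℝ) :
    Real.sqrt (gaussianPdf D μ (a⁻¹ • S) x * gaussianPdf D μ (a • S) x) =
      ((a + a⁻¹) / 2) ^ (-(D : ℝ) / 2) * gaussianPdf D μ (((a + a⁻¹) / 2)⁻¹ • S) x := by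
  have hd := hS.det_pos
  have hc : 0 < (a + a⁻¹) / 2 := by positivity
  rw [gaussianPdf_smul S hS μ _ ha, gaussianPdf_smul S hS μ _ (inv_pos.mpr ha),
    gaussianPdf_smul S hS μ _ (inv_pos.mpr hc)]
  set q := (x - μ) ⬝ᵥ (S⁻¹ *ᵥ (x - μ))
  set c := (a + a⁻¹) / 2 with hcdef
  rw [Real.sqrt_eq_iff_mul_self_eq_of_pos (by positivity), Real.inv_rpow hc.le,
    Real.inv_rpow ha.le, inv_inv, inv_inv]
  have hc' : c ^ (-(D : ℝ) / 2) ≠ 0 := by positivity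
  have ha' : a ^ (-(D : ℝ) / 2) ≠ 0 := by positivity
  have he : Real.exp (-(1 / 2 : ℝ) * (c * q)) * Real.exp (-(1 / 2 : ℝ) * (c * q)) =
      Real.exp (-(1 / 2 : ℝ) * (a * q)) * Real.exp (-(1 / 2 : ℝ) * (a⁻¹ * q)) := by
    rw [← Real.exp_add, ← Real.exp_add]
    congr 1
    rw [hcdef]; ring
  generalize Real.exp (-(1 / 2 : ℝ) * (c * q)) = e at he ⊢
  generalize Real.exp (-(1 / 2 : ℝ) * (a * q)) = e1 at he ⊢
  generalize Real.exp (-(1 / 2 : ℝ) * (a⁻¹ * q)) = e2 at he ⊢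
  field_simp
  linear_combination he

lemma cosh_sub_one_le (x : ℝ) : Real.cosh x - 1 ≤ x ^ 2 / 2 * Real.cosh x := by
  have h1 := Real.cosh_le_exp_half_sq x
  have h2 := Real.one_sub_le_exp_neg (x ^ 2 / 2)
  have h3 := Real.cosh_pos x
  have h4 : Real.cosh x * (1 - x ^ 2 / 2) ≤ 1 := by
    calc _ ≤ Real.cosh x * Real.exp (-(x ^ 2 / 2)) := by gcongr
      _ ≤ Real.exp (x ^ 2 / 2) * Real.exp (-(x ^ 2 / 2)) := by gcongr
      _ = 1 := by rw [← Real.exp_add, add_neg_cancel, Real.exp_zero]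
  linarith

/-- Bound `δ²/4` on the Hellinger-type size of the Gaussian bracket `[l, u]`
with `α = δ/(2√6 D)`. -/
theorem gaussian_bracket_size_bound
    (D : ℕ) (hD : 0 < D) (δ α : ℝ) (hδ0 : 0 < δ) (hδ1 : δ ≤ 1)
    (hα : α = δ / (2 * Real.sqrt 6 * D)) (μ : Fin D → ℝ)
    (St : Matrix (Fin D) (Fin D) ℝ) (hSt : St.PosDef) :
    (∫ x : Fin D → ℝ,
        ((1 + 2 * α) ^ (-(D : ℝ)) * gaussianPdf D μ ((1 + α)⁻¹ • St) x
          + (1 + 2 * α) ^ ((D : ℝ)) * gaussianPdf D μ ((1 + α) • St) x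
          - 2 * Real.sqrt (((1 + 2 * α) ^ (-(D : ℝ)) * gaussianPdf D μ ((1 + α)⁻¹ • St) x) *
              ((1 + 2 * α) ^ ((D : ℝ)) * gaussianPdf D μ ((1 + α) • St) x))) ≤
      2 * (2 * Real.cosh (1 / Real.sqrt 6) * α ^ 2 * D ^ 2 + α ^ 2 * D ^ 2 / 4)) ∧
    2 * (2 * Real.cosh (1 / Real.sqrt 6) * α ^ 2 * D ^ 2 + α ^ 2 * D ^ 2 / 4) ≤
      6 * α ^ 2 * D ^ 2 ∧
    6 * α ^ 2 * D ^ 2 = δ ^ 2 / 4 := by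
  have hDr : (1 : ℝ) ≤ D := by exact_mod_cast hD
  have h6 : Real.sqrt 6 ^ 2 = 6 := Real.sq_sqrt (by norm_num)
  have h6p : 0 < Real.sqrt 6 := by positivity
  have hαp : 0 < α := by rw [hα]; positivity
  have hαD : 2 * α * D = δ / Real.sqrt 6 := by rw [hα]; field_simp
  have hthird : 6 * α ^ 2 * D ^ 2 = δ ^ 2 / 4 := by
    have : 6 * α ^ 2 * D ^ 2 = 6 / 4 * (2 * α * D) ^ 2 := by ring
    rw [this, hαD, div_pow, h6]; ring
  refine ⟨?_, ?_, hthird⟩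
  · have ha : 0 < 1 + α := by linarith
    set a := 1 + α with hadef
    have hc : 0 < (a + a⁻¹) / 2 := by positivity
    have h2a : 0 < 1 + 2 * α := by linarith
    have hsq : ∀ x, Real.sqrt (((1 + 2 * α) ^ (-(D : ℝ)) * gaussianPdf D μ (a⁻¹ • St) x) *
        ((1 + 2 * α) ^ ((D : ℝ)) * gaussianPdf D μ (a • St) x)) =
        ((a + a⁻¹) / 2) ^ (-(D : ℝ) / 2) * gaussianPdf D μ (((a + a⁻¹) / 2)⁻¹ • St) x := by
      intro x
      rw [← sqrt_gaussianPdf St hSt μ a ha x]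
      congr 1
      have : (1 + 2 * α) ^ (-(D : ℝ)) * (1 + 2 * α) ^ (D : ℝ) = 1 := by
        rw [← Real.rpow_add h2a, neg_add_cancel, Real.rpow_zero]
      linear_combination (gaussianPdf D μ (a⁻¹ • St) x * gaussianPdf D μ (a • St) x) * this
    simp_rw [hsq]
    have p1 : (a⁻¹ • St).PosDef := hSt.smul (inv_pos.mpr ha)
    have p2 : (a • St).PosDef := hSt.smul ha
    have p3 : (((a + a⁻¹) / 2)⁻¹ • St).PosDef := hSt.smul (inv_pos.mpr hc)
    have i1 := integrable_gaussianPdf _ p1 μ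
    have i2 := integrable_gaussianPdf _ p2 μ
    have i3 := integrable_gaussianPdf _ p3 μ
    rw [integral_sub (by exact (i1.const_mul _).add (i2.const_mul _)) ((i3.const_mul _).const_mul _),
      integral_add (i1.const_mul _) (i2.const_mul _), integral_const_mul, integral_const_mul,
      integral_const_mul, integral_const_mul, integral_gaussianPdf _ p1,
      integral_gaussianPdf _ p2, integral_gaussianPdf _ p3]
    set y := Real.log (1 + 2 * α) * D with hy
    have hlog0 : 0 ≤ Real.log (1 + 2 * α) := Real.log_nonneg (by linarith)
    have hy0 : 0 ≤ y := by positivity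
    have hlog : Real.log (1 + 2 * α) ≤ 2 * α := by
      have := Real.log_le_sub_one_of_pos h2a; linarith
    have hy1 : y ≤ 2 * α * D := by rw [hy]; gcongr
    have hy2 : y ≤ 1 / Real.sqrt 6 := by
      rw [hαD] at hy1
      exact hy1.trans (by gcongr)
    have e1 : (1 + 2 * α) ^ (-(D : ℝ)) = Real.exp (-y) := by
      rw [Real.rpow_def_of_pos h2a, hy]; congr 1; ring
    have e2 : (1 + 2 * α) ^ (D : ℝ) = Real.exp y := by
      rw [Real.rpow_def_of_pos h2a, hy]
    have hcosh : Real.cosh y - 1 ≤ 2 * Real.cosh (1 / Real.sqrt 6) * α ^ 2 * D ^ 2 := by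
      have hm : Real.cosh y ≤ Real.cosh (1 / Real.sqrt 6) := by
        rw [Real.cosh_le_cosh, abs_of_nonneg hy0, abs_of_nonneg (by positivity)]
        exact hy2
      calc _ ≤ y ^ 2 / 2 * Real.cosh y := cosh_sub_one_le y
        _ ≤ (2 * α * D) ^ 2 / 2 * Real.cosh (1 / Real.sqrt 6) := by
          have := Real.cosh_pos y
          gcongr
        _ = _ := by ring
    have hB : 1 - α ^ 2 * D ^ 2 / 4 ≤ ((a + a⁻¹) / 2) ^ (-(D : ℝ) / 2) := by
      have hcle : (a + a⁻¹) / 2 - 1 ≤ α ^ 2 / 2 := by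
        have : (a + a⁻¹) / 2 - 1 = α ^ 2 / 2 / a := by
          rw [hadef]; field_simp; ring
        rw [this]
        exact div_le_self (by positivity) (by rw [hadef]; linarith)
      have hl := Real.log_le_sub_one_of_pos hc
      rw [Real.rpow_def_of_pos hc]
      have hex := Real.add_one_le_exp (Real.log ((a + a⁻¹) / 2) * (-(D : ℝ) / 2))
      have hl2 : Real.log ((a + a⁻¹) / 2) * D ≤ α ^ 2 / 2 * D := by
        gcongr; linarith
      have hl3 : α ^ 2 * D ≤ α ^ 2 * (D : ℝ) ^ 2 := by
        gcongr; nlinarith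
      linarith
    have hce := Real.cosh_eq y
    rw [e1, e2]
    linarith
  · have h1 := Real.cosh_le_exp_half_sq (1 / Real.sqrt 6)
    rw [div_pow, h6] at h1
    have h2 := Real.exp_bound_div_one_sub_of_interval (x := 1 / 12) (by norm_num) (by norm_num)
    have h3 : Real.cosh (1 / Real.sqrt 6) ≤ 11 / 8 := by
      norm_num at h1 h2 ⊢
      linarith
    have h4 : 0 ≤ α ^ 2 * (D : ℝ) ^ 2 := by positivity
    nlinarith
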